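/- Let Φ be a rank-2 Drinfeld A-module over a finite field L with md odd (m = [L : A/P], d = deg P). Then for every μ ∈ F_q^* and every c ∈ A with P ∤ c and deg c ≤ md/2, any root θ of x^2 - cx + μP^m is an ordinary Weil number: θ is integral over A, |θ|_∞ = q^{md/2}, K(θ)/K is imaginary of degree 2, there is exactly one place of K(θ) above P dividing θ, and Tr_{K(θ)/K}(θ) = c is nonzero mod P. -/

import Mathlib

open Polynomial IntermediateField

noncomputable section
set_option synthInstance.maxHeartbeats 1000000
set_option maxHeartbeats 1000000

variable (Fq : Type) [Field Fq] [Fintype Fq]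

open scoped Classical in
/-- The `∞`-absolute value on `K = F_q(T)`: `|r|_∞ = q^(deg num - deg den)`. -/
def absInfty (r : RatFunc Fq) : ℝ :=
  if r = 0 then 0 else (Fintype.card Fq : ℝ) ^ (r.intDegree)

instance : Algebra (Polynomial Fq) (AlgebraicClosure (RatFunc Fq)) :=
  ((algebraMap (RatFunc Fq) (AlgebraicClosure (RatFunc Fq))).comp
    (algebraMap (Polynomial Fq) (RatFunc Fq))).toAlgebra

theorem IsNonarchimedean.sq_eq_of_quadratic_eq_zero {L : Type*} [Field L] {w : AbsoluteValue L ℝ}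
    (hw : IsNonarchimedean w) {t C N : L} (h : t ^ 2 - C * t + N = 0)
    (hlt : w C ^ 2 < w N) : w t ^ 2 = w N := by
  have hN : w t * w (C - t) = w N := by
    rw [← map_mul]
    congr 1
    linear_combination -h
  rcases lt_or_ge (w C) (w t) with hCt | htC
  · have : w (C - t) = w t := by
      have := hw.add_eq_right_of_lt (x := C) (y := -t) (by simpa using hCt)
      simpa [sub_eq_add_neg] using this
    rw [← hN, this, sq]
  · have : w (C - t) ≤ w C := by
      have := hw C (-t)
      rw [w.map_neg, max_eq_left htC, ← sub_eq_add_neg] at this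
      exact this
    have := mul_le_mul htC this (w.nonneg _) (w.nonneg _)
    nlinarith

theorem AbsoluteValue.isNonarchimedean_of_natCast_le_one {L : Type*} [Field L]
    (w : AbsoluteValue L ℝ) (h : ∀ n : ℕ, w n ≤ 1) : IsNonarchimedean w := by
  let := w.toNormedField
  have : IsUltrametricDist L := IsUltrametricDist.isUltrametricDist_of_forall_norm_natCast_le_one h
  exact IsUltrametricDist.isNonarchimedean_norm

theorem LaurentSeries.order_aeval_X_inv {F : Type*} [Field F] {p : F[X]} (hp : p ≠ 0) :
    (aeval ((PowerSeries.X : PowerSeries F) : LaurentSeries F)⁻¹ p).order = -(p.natDegree : ℤ) := by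
  have hcoeff (k : ℤ) : (aeval ((PowerSeries.X : PowerSeries F) : LaurentSeries F)⁻¹ p).coeff k =
      ∑ i ∈ Finset.range (p.natDegree + 1), if k = -(i : ℤ) then p.coeff i else 0 := by
    rw [HahnSeries.ofPowerSeries_X, HahnSeries.inv_single, aeval_eq_sum_range,
      HahnSeries.coeff_sum]
    refine Finset.sum_congr rfl fun i _ ↦ ?_
    rw [HahnSeries.single_pow, Algebra.smul_def,
      show algebraMap F (LaurentSeries F) (p.coeff i) = HahnSeries.C (p.coeff i) by
        simp [HahnSeries.algebraMap_apply'],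
      HahnSeries.C_mul_eq_smul, HahnSeries.coeff_smul]
    by_cases hk : k = -(i : ℤ) <;> simp [hk]
  have hne : (aeval ((PowerSeries.X : PowerSeries F) : LaurentSeries F)⁻¹ p).coeff
      (-(p.natDegree : ℤ)) ≠ 0 := by
    rw [hcoeff, Finset.sum_eq_single p.natDegree] <;> simp +contextual [hp]
    intro b _ h1 h2
    exact absurd h2.symm h1
  refine le_antisymm (HahnSeries.order_le_of_coeff_ne_zero hne) ?_
  rw [HahnSeries.le_order_iff_forall (fun h ↦ hne (by rw [h, HahnSeries.coeff_zero]))]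
  intro j hj
  rw [hcoeff]
  refine Finset.sum_eq_zero fun i hi ↦ if_neg ?_
  have := Finset.mem_range.1 hi
  omega

theorem LaurentSeries.aeval_X_inv_ne_zero {F : Type*} [Field F] {p : F[X]} (hp : p ≠ 0) :
    aeval ((PowerSeries.X : PowerSeries F) : LaurentSeries F)⁻¹ p ≠ 0 := by
  intro h
  have hord := order_aeval_X_inv (mul_ne_zero hp X_ne_zero)
  rw [map_mul, h, zero_mul, HahnSeries.order_zero, natDegree_mul_X hp] at hord
  omega

theorem LaurentSeries.quadratic_ne_zero_of_odd_order {F : Type*} [Field F] {C N : LaurentSeries F}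
    (hC : C ≠ 0) (hN : N ≠ 0) (hodd : Odd N.order) (hle : N.order ≤ 2 * C.order)
    (t : LaurentSeries F) : t ^ 2 - C * t + N ≠ 0 := by
  intro h
  have hmul : t * (C - t) = N := by linear_combination -h
  have ht : t ≠ 0 := by rintro rfl; simp at hmul; exact hN hmul.symm
  have hs : C - t ≠ 0 := by rintro hs; simp [hs] at hmul; exact hN hmul.symm
  have hord := HahnSeries.order_mul ht hs
  rw [hmul] at hord
  obtain ⟨k, hk⟩ := hodd
  have h1 := HahnSeries.min_order_le_order_add (x := t) (y := C - t) (by simpa using hC)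
  rw [add_sub_cancel] at h1
  have h2 : min C.order t.order ≤ (C - t).order := by
    have := HahnSeries.min_order_le_order_add (x := C) (y := -t) (by simpa [← sub_eq_add_neg])
    simpa [← sub_eq_add_neg] using this
  have h3 : min C.order (C - t).order ≤ t.order := by
    have := HahnSeries.min_order_le_order_add (x := C) (y := -(C - t)) (by simpa)
    rw [HahnSeries.order_neg] at this
    simpa using this
  omega

theorem quadratic_aeval_X_inv_ne_zero {F : Type*} [Field F] {c N : F[X]} (hc : c ≠ 0) (hN : N ≠ 0)
    (hodd : Odd N.natDegree) (hdeg : 2 * c.natDegree ≤ N.natDegree) (t : LaurentSeries F) :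
    t ^ 2 - aeval ((PowerSeries.X : PowerSeries F) : LaurentSeries F)⁻¹ c * t
      + aeval ((PowerSeries.X : PowerSeries F) : LaurentSeries F)⁻¹ N ≠ 0 := by
  refine LaurentSeries.quadratic_ne_zero_of_odd_order (LaurentSeries.aeval_X_inv_ne_zero hc)
    (LaurentSeries.aeval_X_inv_ne_zero hN) ?_ ?_ t
  · rw [LaurentSeries.order_aeval_X_inv hN]
    exact (Int.odd_coe_nat _).2 hodd |>.neg
  · rw [LaurentSeries.order_aeval_X_inv hN, LaurentSeries.order_aeval_X_inv hc]
    omega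

theorem existsUnique_isMaximal_mem_integralClosure {A K L : Type*} [CommRing A] [IsDomain A]
    [IsIntegrallyClosed A] [Field K] [Algebra A K] [IsFractionRing A K] [Field L] [Algebra K L]
    [Algebra A L] [IsScalarTower A K L] (pb : PowerBasis K L) (hdim : pb.dim = 2) {P c N : A}
    (hP : (Ideal.span {P}).IsMaximal) (hc : ¬ P ∣ c) (hPN : P ∣ N) {t : L} (hgen : pb.gen = t)
    (hquad : t ^ 2 - algebraMap A L c * t + algebraMap A L N = 0)
    (htrace : Algebra.trace K L t = algebraMap A K c) (hint : t ∈ integralClosure A L) :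
    ∃! Q : Ideal (integralClosure A L), Q.IsMaximal ∧
      algebraMap A (integralClosure A L) P ∈ Q ∧ (⟨t, hint⟩ : integralClosure A L) ∈ Q := by
  have hrank : Module.finrank K L = 2 := pb.finrank.trans hdim
  have : FiniteDimensional K L := pb.finite
  set B := integralClosure A L
  have htr (x : B) : ∃ a : A, algebraMap A K a = Algebra.trace K L x :=
    IsIntegrallyClosed.isIntegral_iff.1 (Algebra.isIntegral_trace x.2)
  choose tr htr using htr
  have hone : Algebra.trace K L 1 = 2 := by
    rw [← map_one (algebraMap K L), Algebra.trace_algebraMap, hrank]; simp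
  have hinj : Function.Injective (algebraMap A K) := IsFractionRing.injective A K
  set τ : B := ⟨t, hint⟩
  have hτquad : τ * (algebraMap A B c - τ) = algebraMap A B N := by
    apply Subtype.ext
    change t * (algebraMap A L c - t) = algebraMap A L N
    linear_combination -hquad
  have hspan (y : L) : ∃ u v : K, y = algebraMap K L u + algebraMap K L v * t := by
    obtain ⟨f, hf, rfl⟩ := pb.exists_eq_aeval y
    obtain ⟨v, u, rfl⟩ := exists_eq_X_add_C_of_natDegree_le_one (p := f) (by omega)
    exact ⟨u, v, by simp [hgen, add_comm]⟩
  have htrmul (y : L) : algebraMap K L (Algebra.trace K L (y * (algebraMap A L c - t))) =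
      y * (algebraMap A L c - t) + (algebraMap K L (Algebra.trace K L y) - y) * t := by
    obtain ⟨u, v, rfl⟩ := hspan y
    have h1 : (algebraMap K L u + algebraMap K L v * t) * (algebraMap A L c - t) =
        u • (algebraMap K L (algebraMap A K c)) - u • t
          + v • algebraMap K L (algebraMap A K N) := by
      simp only [Algebra.smul_def, ← IsScalarTower.algebraMap_apply A K L]
      linear_combination -(algebraMap K L v) * hquad
    have h2 : algebraMap K L u + algebraMap K L v * t = u • 1 + v • t := by
      simp [Algebra.smul_def]
    have h3 : Algebra.trace K L (u • 1 + v • t) = u * 2 + v * algebraMap A K c := by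
      simp [hone, htrace]
    have h4 : Algebra.trace K L (u • (algebraMap K L (algebraMap A K c)) - u • t
          + v • algebraMap K L (algebraMap A K N)) =
        u * algebraMap A K c + v * (2 * algebraMap A K N) := by
      simp [Algebra.trace_algebraMap, hrank, htrace]; ring
    rw [h1, h4, ← h1, h2, h3]
    simp only [Algebra.smul_def, map_add, map_mul, ← IsScalarTower.algebraMap_apply A K L,
      map_ofNat, mul_one]
    linear_combination (2 * algebraMap K L v) * hquad
  have hcomap (Q : Ideal B) (hQ : Q.IsMaximal) (hPQ : algebraMap A B P ∈ Q) (a : A) :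
      algebraMap A B a ∈ Q ↔ P ∣ a := by
    have := hP.eq_of_le (J := Q.comap (algebraMap A B)) (Ideal.comap_ne_top _ hQ.ne_top)
      (by simpa [Ideal.span_singleton_le_iff_mem] using hPQ)
    rw [← Ideal.mem_span_singleton, this, Ideal.mem_comap]
  have hmem (Q : Ideal B) (hQ : Q.IsMaximal ∧ algebraMap A B P ∈ Q ∧ τ ∈ Q) (y : B) :
      y ∈ Q ↔ P ∣ tr (y * (algebraMap A B c - τ)) := by
    obtain ⟨hQm, hPQ, hτQ⟩ := hQ
    rw [← hcomap Q hQm hPQ]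
    have h1 : algebraMap A B (tr (y * (algebraMap A B c - τ))) =
        y * (algebraMap A B c - τ) + (algebraMap A B (tr y) - y) * τ := by
      apply Subtype.ext
      change algebraMap A L _ = (y : L) * (algebraMap A L c - t) + (algebraMap A L (tr y) - y) * t
      rw [IsScalarTower.algebraMap_apply A K L, htr, IsScalarTower.algebraMap_apply A K L (tr y),
        htr]
      exact htrmul y
    have h2 : algebraMap A B c - τ ∉ Q := by
      rwa [sub_eq_add_neg, Ideal.add_mem_iff_left _ (Q.neg_mem hτQ), hcomap Q hQm hPQ]
    rw [h1, Ideal.add_mem_iff_left _ (Q.mul_mem_left _ hτQ)]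
    exact ⟨fun h ↦ Q.mul_mem_right _ h,
      fun h ↦ (hQm.isPrime.mem_or_mem h).resolve_right h2⟩
  have hproper : Ideal.span {algebraMap A B P, τ} ≠ ⊤ := by
    rw [Ne, Ideal.eq_top_iff_one, Ideal.mem_span_pair]
    rintro ⟨a, b, hab⟩
    obtain ⟨N', rfl⟩ := hPN
    have h1 : algebraMap A B c - τ =
        P • (a * (algebraMap A B c - τ) + b * algebraMap A B N') := by
      rw [map_mul] at hτquad
      rw [Algebra.smul_def]
      linear_combination (-(algebraMap A B c - τ)) * hab + b * hτquad
    apply hc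
    refine ⟨tr (a * (algebraMap A B c - τ) + b * algebraMap A B N'), hinj ?_⟩
    rw [map_mul, htr, ← smul_eq_mul, algebraMap_smul, ← LinearMap.map_smul_of_tower]
    have h2 := congrArg (fun x : B ↦ Algebra.trace K L (x : L)) h1
    have h3 : Algebra.trace K L ((algebraMap A B c - τ : B) : L) = algebraMap A K c := by
      change Algebra.trace K L (algebraMap A L c - t) = _
      rw [map_sub, htrace, IsScalarTower.algebraMap_apply A K L, Algebra.trace_algebraMap, hrank]
      ring
    rw [← h3]
    exact h2
  obtain ⟨Q, hQ, hle⟩ := Ideal.exists_le_maximal _ hproper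
  have hQ' : Q.IsMaximal ∧ algebraMap A B P ∈ Q ∧ τ ∈ Q :=
    ⟨hQ, hle (Ideal.subset_span (by simp)), hle (Ideal.subset_span (by simp))⟩
  refine ⟨Q, hQ', fun Q' hQ'' ↦ ?_⟩
  ext y
  rw [hmem Q hQ', hmem Q' hQ'']

/-- With `md` odd (`m = [L : A/P]`, `d = deg P`), for every `μ ∈ F_qˣ` and every `c ∈ A`
with `P ∤ c` and `deg c ≤ md/2`, any root `θ` of `x² - cx + μP^m` is an ordinary Weil
number: `θ` is integral over `A`, `|θ|_∞ = q^{md/2}` for any absolute value extending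
`|·|_∞`, `K(θ)/K` is imaginary (no root of the polynomial lies in `K_∞ = F_q((1/T))`)
of degree 2, there is exactly one maximal ideal of the integral closure of `A` in `K(θ)`
containing both `P` and `θ`, and `Tr_{K(θ)/K}(θ) = c`, which is nonzero mod `P`. -/
theorem root_is_ordinary_weil_number
    (P : Polynomial Fq) (hP : Irreducible P) (hPm : P.Monic)
    (d m : ℕ) (hd : P.natDegree = d) (hm : 0 < m) (hodd : Odd (m * d))
    (μ : Fqˣ) (c : Polynomial Fq) (hc : ¬ P ∣ c) (hdeg : 2 * c.natDegree ≤ m * d)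
    (θ : AlgebraicClosure (RatFunc Fq))
    (hθ : θ ^ 2 - algebraMap (Polynomial Fq) _ c * θ
        + algebraMap (Polynomial Fq) _ ((μ : Fq) • P ^ m) = 0) :
    IsIntegral (Polynomial Fq) θ ∧
    (∀ w : AbsoluteValue (IntermediateField.adjoin (RatFunc Fq) {θ}) ℝ,
      (∀ x : RatFunc Fq,
        w (algebraMap (RatFunc Fq) (IntermediateField.adjoin (RatFunc Fq) {θ}) x)
          = absInfty Fq x) →
      w (IntermediateField.AdjoinSimple.gen (RatFunc Fq) θ)
        = ((Fintype.card Fq : ℝ) ^ (m * d : ℕ)) ^ ((1 : ℝ) / 2)) ∧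
    (∀ θ' : LaurentSeries Fq,
      θ' ^ 2 - Polynomial.aeval ((PowerSeries.X : PowerSeries Fq) : LaurentSeries Fq)⁻¹ c * θ'
        + algebraMap Fq (LaurentSeries Fq) (μ : Fq)
          * Polynomial.aeval ((PowerSeries.X : PowerSeries Fq) : LaurentSeries Fq)⁻¹ P ^ m
        ≠ 0) ∧
    Module.finrank (RatFunc Fq) (IntermediateField.adjoin (RatFunc Fq) {θ}) = 2 ∧
    (letI : Algebra (Polynomial Fq) (IntermediateField.adjoin (RatFunc Fq) {θ}) :=
      ((algebraMap (RatFunc Fq) (IntermediateField.adjoin (RatFunc Fq) {θ})).comp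
        (algebraMap (Polynomial Fq) (RatFunc Fq))).toAlgebra
     ∀ hgen : IntermediateField.AdjoinSimple.gen (RatFunc Fq) θ ∈
        integralClosure (Polynomial Fq) (IntermediateField.adjoin (RatFunc Fq) {θ}),
     ∃! Q : Ideal
        (integralClosure (Polynomial Fq) (IntermediateField.adjoin (RatFunc Fq) {θ})),
      Q.IsMaximal ∧
        algebraMap (Polynomial Fq)
          (integralClosure (Polynomial Fq) (IntermediateField.adjoin (RatFunc Fq) {θ})) P ∈ Q ∧
        (⟨IntermediateField.AdjoinSimple.gen (RatFunc Fq) θ, hgen⟩ :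
          integralClosure (Polynomial Fq) (IntermediateField.adjoin (RatFunc Fq) {θ})) ∈ Q) ∧
    Algebra.trace (RatFunc Fq) (IntermediateField.adjoin (RatFunc Fq) {θ})
        (IntermediateField.AdjoinSimple.gen (RatFunc Fq) θ)
      = algebraMap (Polynomial Fq) (RatFunc Fq) c ∧
    ¬ P ∣ c := by
  have hP0 : P ≠ 0 := hP.ne_zero
  have hc0 : c ≠ 0 := by rintro rfl; exact hc (dvd_zero P)
  have hμ : (μ : Fq) ≠ 0 := μ.ne_zero
  set N : Fq[X] := (μ : Fq) • P ^ m with hNdef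
  have hN0 : N ≠ 0 := smul_ne_zero hμ (pow_ne_zero m hP0)
  have hNdeg : N.natDegree = m * d := by
    rw [hNdef, natDegree_smul _ hμ, natDegree_pow, hd]
  have hlaurent (θ' : LaurentSeries Fq) :
      θ' ^ 2 - aeval ((PowerSeries.X : PowerSeries Fq) : LaurentSeries Fq)⁻¹ c * θ'
        + aeval ((PowerSeries.X : PowerSeries Fq) : LaurentSeries Fq)⁻¹ N ≠ 0 :=
    quadratic_aeval_X_inv_ne_zero hc0 hN0 (hNdeg ▸ hodd) (hNdeg ▸ hdeg) θ'
  set c' : RatFunc Fq := algebraMap Fq[X] (RatFunc Fq) c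
  set N' : RatFunc Fq := algebraMap Fq[X] (RatFunc Fq) N
  set f : (RatFunc Fq)[X] := X ^ 2 - C c' * X + C N' with hf
  have hfdeg : f.natDegree = 2 := by rw [hf]; compute_degree!
  have hfmonic : f.Monic := by rw [hf]; monicity!
  have hroot (r : RatFunc Fq) : r ^ 2 - c' * r + N' ≠ 0 := by
    intro hr
    have hint : IsIntegral Fq[X] r :=
      ⟨X ^ 2 - C c * X + C N, by monicity!, by simpa using hr⟩
    obtain ⟨a, rfl⟩ := IsIntegrallyClosed.isIntegral_iff.1 hint
    apply hlaurent (aeval ((PowerSeries.X : PowerSeries Fq) : LaurentSeries Fq)⁻¹ a)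
    have ha : a ^ 2 - c * a + N = 0 := by
      apply IsFractionRing.injective Fq[X] (RatFunc Fq)
      simpa using hr
    simpa using congrArg (aeval ((PowerSeries.X : PowerSeries Fq) : LaurentSeries Fq)⁻¹) ha
  have hirr : Irreducible f := by
    rw [hfmonic.irreducible_iff_roots_eq_zero_of_degree_le_three hfdeg.ge (by omega)]
    refine Multiset.eq_zero_of_forall_notMem fun r hr ↦ hroot r ?_
    simpa [hf] using (mem_roots'.1 hr).2
  have hθ' : θ ^ 2 - algebraMap (RatFunc Fq) _ c' * θ + algebraMap (RatFunc Fq) _ N' = 0 := hθ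
  have hmin : minpoly (RatFunc Fq) θ = f :=
    (minpoly.eq_of_irreducible_of_monic hirr (by simpa [hf] using hθ') hfmonic).symm
  have hintK : IsIntegral (RatFunc Fq) θ := ⟨f, hfmonic, by simpa [hf] using hθ'⟩
  set g := AdjoinSimple.gen (RatFunc Fq) θ
  let pb := adjoin.powerBasis hintK
  have hgen : pb.gen = g := adjoin.powerBasis_gen hintK
  have hdim : pb.dim = 2 := by
    rw [adjoin.powerBasis_dim, hmin, hfdeg]
  have hgquad : g ^ 2 - algebraMap (RatFunc Fq) _ c' * g + algebraMap (RatFunc Fq) _ N' = 0 :=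
    Subtype.ext hθ'
  have htrace : Algebra.trace (RatFunc Fq) (RatFunc Fq)⟮θ⟯ g = c' := by
    rw [← hgen, PowerBasis.trace_gen_eq_nextCoeff_minpoly, hgen, minpoly_gen, hmin,
      nextCoeff_of_natDegree_pos (by omega), hfdeg, hf]
    simp [coeff_C]
  refine ⟨⟨X ^ 2 - C c * X + C N, by monicity!, by simpa using hθ⟩, ?_, ?_,
    pb.finrank.trans hdim, ?_, htrace, hc⟩
  · intro w hw
    have hwp {p : Fq[X]} (hp : p ≠ 0) :
        w (algebraMap (RatFunc Fq) _ (algebraMap Fq[X] (RatFunc Fq) p)) =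
          (Fintype.card Fq : ℝ) ^ p.natDegree := by
      rw [hw, absInfty, if_neg (by simpa using hp), RatFunc.intDegree_polynomial, zpow_natCast]
    have hna : IsNonarchimedean w := by
      refine w.isNonarchimedean_of_natCast_le_one fun n ↦ ?_
      by_cases hn : (n : Fq[X]) = 0
      · have : (n : (RatFunc Fq)⟮θ⟯) = 0 := by
          simpa using congrArg (fun p ↦ algebraMap (RatFunc Fq) (RatFunc Fq)⟮θ⟯
            (algebraMap Fq[X] (RatFunc Fq) p)) hn
        simp [this]
      · simpa using (hwp hn).le
    have hq : (1 : ℝ) < Fintype.card Fq := by exact_mod_cast Fintype.one_lt_card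
    have hlt : w (algebraMap (RatFunc Fq) _ c') ^ 2 < w (algebraMap (RatFunc Fq) _ N') := by
      rw [hwp hc0, hwp hN0, ← pow_mul, hNdeg]
      refine pow_lt_pow_right₀ hq ?_
      obtain ⟨k, hk⟩ := hodd
      omega
    have := hna.sq_eq_of_quadratic_eq_zero hgquad hlt
    rw [hwp hN0, hNdeg] at this
    rw [← this, ← Real.sqrt_eq_rpow, Real.sqrt_sq (w.nonneg _)]
  · intro θ'
    simpa [hNdef, Algebra.smul_def] using hlaurent θ'
  · intro hgenint
    let : Algebra Fq[X] (RatFunc Fq)⟮θ⟯ := ((algebraMap (RatFunc Fq) (RatFunc Fq)⟮θ⟯).comp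
      (algebraMap Fq[X] (RatFunc Fq))).toAlgebra
    have : IsScalarTower Fq[X] (RatFunc Fq) (RatFunc Fq)⟮θ⟯ := IsScalarTower.of_algebraMap_eq' rfl
    exact existsUnique_isMaximal_mem_integralClosure pb hdim
      (PrincipalIdealRing.isMaximal_of_irreducible hP) hc
      (N := N) ((dvd_pow_self P hm.ne').trans ⟨C (μ : Fq), by rw [hNdef, smul_eq_C_mul, mul_comm]⟩)
      hgen hgquad htrace hgenint

end
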